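/- Let n ≥ 1, let Q = 2n + 2, let Ω ⊂ ℝ^{2n+1} be a bounded open set with smooth boundary containing the origin, let 1 < q < 2 and let p satisfy 1/p + 1/q = 1. Then there exists a constant C > 0 such that for every real-valued φ ∈ C_c^∞(Ω), the interpolation inequality holds: [ ∫_Ω |∇_ℍ φ|² dz dt − ((Q − 2)/2)² ∫_Ω (|z|²/ρ⁴) φ² dz dt ]^{1/2} · ( ∫_Ω |z|^p |φ|^p dz dt )^{1/p} ≥ √C · ((Q − q)/q) · ∫_Ω (|z|²/ρ²) φ² dz dt. (The bracketed quantity is nonnegative by the Hardy inequality on ℍⁿ.) -/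

import Mathlib

open MeasureTheory Real

noncomputable section

/-- The underlying space of the Heisenberg group ℍⁿ, identified with ℝ^{2n+1}:
points `(x, y, t)` with `x y : Fin n → ℝ`, `t : ℝ`; write `z = (x, y)`. -/
abbrev Hspace (n : ℕ) : Type := (Fin n → ℝ) × (Fin n → ℝ) × ℝ

/-- The horizontal vector field `X_j f = ∂f/∂x_j + 2 y_j ∂f/∂t`. -/
def Xd (n : ℕ) (j : Fin n) (f : Hspace n → ℝ) (p : Hspace n) : ℝ :=
  fderiv ℝ f p (Pi.single j 1, 0, 0) + 2 * p.2.1 j * fderiv ℝ f p (0, 0, 1)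

/-- The horizontal vector field `Y_j f = ∂f/∂y_j − 2 x_j ∂f/∂t`. -/
def Yd (n : ℕ) (j : Fin n) (f : Hspace n → ℝ) (p : Hspace n) : ℝ :=
  fderiv ℝ f p (0, Pi.single j 1, 0) - 2 * p.1 j * fderiv ℝ f p (0, 0, 1)

/-- Squared length of the horizontal gradient: `|∇_ℍ f|² = Σ_j ((X_j f)² + (Y_j f)²)`. -/
def gradH2 (n : ℕ) (f : Hspace n → ℝ) (p : Hspace n) : ℝ :=
  ∑ j : Fin n, ((Xd n j f p) ^ 2 + (Yd n j f p) ^ 2)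

/-- The Kohn sub-Laplacian `Δ_ℍ f = Σ_j (X_j(X_j f) + Y_j(Y_j f))`. -/
def lapH (n : ℕ) (f : Hspace n → ℝ) (p : Hspace n) : ℝ :=
  ∑ j : Fin n, (Xd n j (Xd n j f) p + Yd n j (Yd n j f) p)

/-- `|z|² = |x|² + |y|²`. -/
def zSq (n : ℕ) (p : Hspace n) : ℝ := ∑ j : Fin n, ((p.1 j) ^ 2 + (p.2.1 j) ^ 2)

/-- The homogeneous norm `ρ(z, t) = (|z|⁴ + t²)^{1/4}`. -/
def rho (n : ℕ) (p : Hspace n) : ℝ := ((zSq n p) ^ 2 + p.2.2 ^ 2) ^ ((4 : ℝ)⁻¹)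

lemma Xd_eq (n : ℕ) (j : Fin n) (f : Hspace n → ℝ) (p : Hspace n) :
    Xd n j f p = fderiv ℝ f p (Pi.single j 1, 0, 2 * p.2.1 j) := by
  have : ((Pi.single j 1, 0, 2 * p.2.1 j) : Hspace n) =
      (Pi.single j 1, 0, 0) + (2 * p.2.1 j) • ((0, 0, 1) : Hspace n) := by
    ext <;> simp
  rw [this, map_add, map_smul, Xd, smul_eq_mul]

lemma Yd_eq (n : ℕ) (j : Fin n) (f : Hspace n → ℝ) (p : Hspace n) :
    Yd n j f p = fderiv ℝ f p (0, Pi.single j 1, -(2 * p.1 j)) := by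
  have : ((0, Pi.single j 1, -(2 * p.1 j)) : Hspace n) =
      (0, Pi.single j 1, 0) + (-(2 * p.1 j)) • ((0, 0, 1) : Hspace n) := by
    ext <;> simp
  rw [this, map_add, map_smul, Yd, smul_eq_mul]; ring

lemma contDiff_zSq (n : ℕ) : ContDiff ℝ 1 (zSq n) := by
  unfold zSq; fun_prop

lemma fderiv_zSq (n : ℕ) (p v : Hspace n) :
    fderiv ℝ (zSq n) p v = ∑ j, (2 * p.1 j * v.1 j + 2 * p.2.1 j * v.2.1 j) := by
  have h1 : ∀ j : Fin n, HasFDerivAt (fun p : Hspace n => p.1 j)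
      ((ContinuousLinearMap.proj j).comp (ContinuousLinearMap.fst ℝ _ _)) p := fun j =>
    ((ContinuousLinearMap.proj (R := ℝ) (φ := fun _ : Fin n => ℝ) j).comp
      (ContinuousLinearMap.fst ℝ (Fin n → ℝ) ((Fin n → ℝ) × ℝ))).hasFDerivAt
  have h2 : ∀ j : Fin n, HasFDerivAt (fun p : Hspace n => p.2.1 j)
      ((ContinuousLinearMap.proj j).comp ((ContinuousLinearMap.fst ℝ _ _).comp
        (ContinuousLinearMap.snd ℝ _ _))) p := fun j =>
    ((ContinuousLinearMap.proj (R := ℝ) (φ := fun _ : Fin n => ℝ) j).comp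
      ((ContinuousLinearMap.fst ℝ (Fin n → ℝ) ℝ).comp
      (ContinuousLinearMap.snd ℝ (Fin n → ℝ) ((Fin n → ℝ) × ℝ)))).hasFDerivAt
  have h : HasFDerivAt (zSq n) _ p :=
    HasFDerivAt.fun_sum (u := Finset.univ) (fun j _ => ((h1 j).pow 2).add ((h2 j).pow 2))
  rw [h.fderiv]
  simp

/-- regularised `ρ⁴`. -/
def NN (n : ℕ) (δ : ℝ) (p : Hspace n) : ℝ := (zSq n p) ^ 2 + p.2.2 ^ 2 + δ

lemma zSq_nonneg (n : ℕ) (p : Hspace n) : 0 ≤ zSq n p :=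
  Finset.sum_nonneg fun j _ => by positivity

lemma NN_pos (n : ℕ) {δ : ℝ} (h : 0 < δ) (p : Hspace n) : 0 < NN n δ p := by
  unfold NN; positivity

lemma contDiff_NN (n : ℕ) (δ : ℝ) : ContDiff ℝ 1 (NN n δ) := by
  unfold NN; have := contDiff_zSq n; fun_prop

lemma fderiv_t (n : ℕ) (p v : Hspace n) :
    fderiv ℝ (fun p : Hspace n => p.2.2) p v = v.2.2 := by
  have : HasFDerivAt (fun p : Hspace n => p.2.2) _ p :=
    ((ContinuousLinearMap.snd ℝ (Fin n → ℝ) ℝ).comp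
      (ContinuousLinearMap.snd ℝ (Fin n → ℝ) ((Fin n → ℝ) × ℝ))).hasFDerivAt
  rw [this.fderiv]; rfl

lemma fderiv_x (n : ℕ) (j : Fin n) (p v : Hspace n) :
    fderiv ℝ (fun p : Hspace n => p.1 j) p v = v.1 j := by
  have h1 : HasFDerivAt (fun p : Hspace n => p.1 j) _ p := 
    ((ContinuousLinearMap.proj (R := ℝ) (φ := fun _ : Fin n => ℝ) j).comp
      (ContinuousLinearMap.fst ℝ (Fin n → ℝ) ((Fin n → ℝ) × ℝ))).hasFDerivAt
  rw [h1.fderiv]; rfl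

lemma fderiv_y (n : ℕ) (j : Fin n) (p v : Hspace n) :
    fderiv ℝ (fun p : Hspace n => p.2.1 j) p v = v.2.1 j := by
  have h1 : HasFDerivAt (fun p : Hspace n => p.2.1 j) _ p := 
    ((ContinuousLinearMap.proj (R := ℝ) (φ := fun _ : Fin n => ℝ) j).comp
      ((ContinuousLinearMap.fst ℝ (Fin n → ℝ) ℝ).comp
      (ContinuousLinearMap.snd ℝ (Fin n → ℝ) ((Fin n → ℝ) × ℝ)))).hasFDerivAt
  rw [h1.fderiv]; rfl

/-- `X_j N` -/
def PX (n : ℕ) (j : Fin n) (p : Hspace n) : ℝ := 4 * (zSq n p * p.1 j) + 4 * (p.2.1 j * p.2.2)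
/-- `Y_j N` -/
def PY (n : ℕ) (j : Fin n) (p : Hspace n) : ℝ := 4 * (zSq n p * p.2.1 j) - 4 * (p.1 j * p.2.2)

lemma contDiff_PX (n : ℕ) (j : Fin n) : ContDiff ℝ 1 (PX n j) := by
  unfold PX; have := contDiff_zSq n; fun_prop
lemma contDiff_PY (n : ℕ) (j : Fin n) : ContDiff ℝ 1 (PY n j) := by
  unfold PY; have := contDiff_zSq n; fun_prop

lemma fderiv_NN (n : ℕ) (δ : ℝ) (p v : Hspace n) :
    fderiv ℝ (NN n δ) p v = 2 * zSq n p * fderiv ℝ (zSq n) p v + 2 * p.2.2 * v.2.2 := by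
  have h1 := ((contDiff_zSq n).differentiable one_ne_zero p).hasFDerivAt
  have h2 := (show DifferentiableAt ℝ (fun p : Hspace n => p.2.2) p by fun_prop).hasFDerivAt
  have h : HasFDerivAt (NN n δ) _ p := ((h1.pow 2).add (h2.pow 2)).add_const δ
  rw [h.fderiv]
  simp [fderiv_t]

lemma fderiv_PX (n : ℕ) (j : Fin n) (p v : Hspace n) :
    fderiv ℝ (PX n j) p v = 4 * (zSq n p * v.1 j + p.1 j * fderiv ℝ (zSq n) p v)
      + 4 * (p.2.1 j * v.2.2 + p.2.2 * v.2.1 j) := by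
  have h1 := ((contDiff_zSq n).differentiable one_ne_zero p).hasFDerivAt
  have h2 := (show DifferentiableAt ℝ (fun p : Hspace n => p.2.2) p by fun_prop).hasFDerivAt
  have h3 := (show DifferentiableAt ℝ (fun p : Hspace n => p.1 j) p by fun_prop).hasFDerivAt
  have h4 := (show DifferentiableAt ℝ (fun p : Hspace n => p.2.1 j) p by fun_prop).hasFDerivAt
  have h : HasFDerivAt (PX n j) _ p := ((h1.mul h3).const_mul 4).add ((h4.mul h2).const_mul 4)
  rw [h.fderiv]
  simp [fderiv_t, fderiv_x, fderiv_y]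
  ring

lemma fderiv_PY (n : ℕ) (j : Fin n) (p v : Hspace n) :
    fderiv ℝ (PY n j) p v = 4 * (zSq n p * v.2.1 j + p.2.1 j * fderiv ℝ (zSq n) p v)
      - 4 * (p.1 j * v.2.2 + p.2.2 * v.1 j) := by
  have h1 := ((contDiff_zSq n).differentiable one_ne_zero p).hasFDerivAt
  have h2 := (show DifferentiableAt ℝ (fun p : Hspace n => p.2.2) p by fun_prop).hasFDerivAt
  have h3 := (show DifferentiableAt ℝ (fun p : Hspace n => p.1 j) p by fun_prop).hasFDerivAt
  have h4 := (show DifferentiableAt ℝ (fun p : Hspace n => p.2.1 j) p by fun_prop).hasFDerivAt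
  have h : HasFDerivAt (PY n j) _ p := ((h1.mul h4).const_mul 4).sub ((h3.mul h2).const_mul 4)
  rw [h.fderiv]
  simp [fderiv_t, fderiv_x, fderiv_y]
  ring

lemma Xd_zSq (n : ℕ) (j : Fin n) (p : Hspace n) : 
    fderiv ℝ (zSq n) p (Pi.single j 1, 0, 2 * p.2.1 j) = 2 * p.1 j := by
  rw [fderiv_zSq]; simp [Pi.single_apply]
lemma Yd_zSq (n : ℕ) (j : Fin n) (p : Hspace n) : 
    fderiv ℝ (zSq n) p (0, Pi.single j 1, -(2 * p.1 j)) = 2 * p.2.1 j := by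
  rw [fderiv_zSq]; simp [Pi.single_apply]

lemma Xd_NN (n : ℕ) (j : Fin n) (δ : ℝ) (p : Hspace n) : 
    fderiv ℝ (NN n δ) p (Pi.single j 1, 0, 2 * p.2.1 j) = PX n j p := by
  rw [fderiv_NN, Xd_zSq]; simp only [PX]; ring
lemma Yd_NN (n : ℕ) (j : Fin n) (δ : ℝ) (p : Hspace n) : 
    fderiv ℝ (NN n δ) p (0, Pi.single j 1, -(2 * p.1 j)) = PY n j p := by
  rw [fderiv_NN, Yd_zSq]; simp only [PY]; ring

lemma Xd_PX (n : ℕ) (j : Fin n) (p : Hspace n) : 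
    fderiv ℝ (PX n j) p (Pi.single j 1, 0, 2 * p.2.1 j) =
      4 * zSq n p + 8 * (p.1 j ^ 2 + p.2.1 j ^ 2) := by
  rw [fderiv_PX, Xd_zSq]; simp; ring
lemma Yd_PY (n : ℕ) (j : Fin n) (p : Hspace n) : 
    fderiv ℝ (PY n j) p (0, Pi.single j 1, -(2 * p.1 j)) =
      4 * zSq n p + 8 * (p.1 j ^ 2 + p.2.1 j ^ 2) := by
  rw [fderiv_PY, Yd_zSq]; simp; ring

lemma sum_P (n : ℕ) (p : Hspace n) : 
    ∑ j, (PX n j p ^ 2 + PY n j p ^ 2) = 16 * zSq n p * NN n 0 p := by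
  have : ∀ j, PX n j p ^ 2 + PY n j p ^ 2 =
      (16 * (zSq n p ^ 2 + p.2.2 ^ 2)) * (p.1 j ^ 2 + p.2.1 j ^ 2) := fun j => by
    simp only [PX, PY]; ring
  simp_rw [this, ← Finset.mul_sum]
  change _ * zSq n p = _
  simp only [NN]; ring

/-- the vector field components and derivative -/
lemma fderiv_W (n : ℕ) (δ : ℝ) (φ R : Hspace n → ℝ) (F : ℝ → ℝ) (F' : ℝ) (p v : Hspace n)
    (hφ : DifferentiableAt ℝ φ p) (hR : DifferentiableAt ℝ R p)
    (hF : HasDerivAt F F' (NN n δ p)) :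
    fderiv ℝ (fun p => φ p ^ 2 * (F (NN n δ p) * R p)) p v =
      2 * φ p * fderiv ℝ φ p v * (F (NN n δ p) * R p) +
      φ p ^ 2 * (F' * fderiv ℝ (NN n δ) p v * R p + F (NN n δ p) * fderiv ℝ R p v) := by
  have h1 := ((contDiff_NN n δ).differentiable one_ne_zero p).hasFDerivAt
  have h : HasFDerivAt (fun p => φ p ^ 2 * (F (NN n δ p) * R p)) _ p :=
    (hφ.hasFDerivAt.pow 2).mul ((hF.comp_hasFDerivAt p h1).mul hR.hasFDerivAt)
  rw [h.fderiv]
  simp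
  ring

instance haar_aux (n : ℕ) : (volume : Measure ((Fin n → ℝ) × ℝ)).IsAddHaarMeasure :=
  Measure.prod.instIsAddHaarMeasure (volume : Measure (Fin n → ℝ)) (volume : Measure ℝ)

instance haar_H (n : ℕ) : (volume : Measure (Hspace n)).IsAddHaarMeasure :=
  Measure.prod.instIsAddHaarMeasure (volume : Measure (Fin n → ℝ))
    (volume : Measure ((Fin n → ℝ) × ℝ))

lemma integral_Xd (n : ℕ) (j : Fin n) (f : Hspace n → ℝ) (hf : ContDiff ℝ 1 f)
    (hc : HasCompactSupport f) : Integrable (Xd n j f) ∧ ∫ p, Xd n j f p = 0 := by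
  have hd : ∀ v, Continuous (fun p => fderiv ℝ f p v) := fun v =>
    (hf.continuous_fderiv one_ne_zero).clm_apply continuous_const
  have hs : ∀ v, HasCompactSupport (fun p => fderiv ℝ f p v) := fun v =>
    hc.fderiv_apply (𝕜 := ℝ) v
  have hi : ∀ v, Integrable (fun p => fderiv ℝ f p v) := fun v =>
    (hd v).integrable_of_hasCompactSupport (hs v)
  have hg : DifferentiableAt ℝ (fun p : Hspace n => 2 * p.2.1 j) 0 := by fun_prop
  have i2 : Integrable (fun p : Hspace n => 2 * p.2.1 j * fderiv ℝ f p (0, 0, 1)) :=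
    ((by fun_prop : Continuous fun p : Hspace n => 2 * p.2.1 j).mul
      (hd _)).integrable_of_hasCompactSupport ((hs _).mul_left)
  have i3 : Integrable (fun p : Hspace n => 2 * p.2.1 j * f p) :=
    ((by fun_prop : Continuous fun p : Hspace n => 2 * p.2.1 j).mul
      hf.continuous).integrable_of_hasCompactSupport (hc.mul_left)
  have fz : ∀ p : Hspace n, fderiv ℝ (fun p : Hspace n => 2 * p.2.1 j) p (0,0,1) = 0 := by
    intro p
    rw [fderiv_const_mul (by fun_prop)]
    simp [fderiv_y]
  refine ⟨(hi _).add i2, ?_⟩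
  unfold Xd
  rw [integral_add (hi _) i2]
  have e1 := integral_mul_fderiv_eq_neg_fderiv_mul_of_integrable (μ := (volume : Measure (Hspace n)))
    (f := fun _ : Hspace n => (1:ℝ)) (g := f) (v := (Pi.single j 1, 0, 0)) (by simp)
    (by simpa using hi _) (by simpa using hf.continuous.integrable_of_hasCompactSupport hc)
    (fun x _ => by fun_prop) (fun x _ => hf.differentiable one_ne_zero x)
  have e2 := integral_mul_fderiv_eq_neg_fderiv_mul_of_integrable (μ := (volume : Measure (Hspace n)))
    (f := fun p : Hspace n => 2 * p.2.1 j) (g := f) (v := (0, 0, 1)) (by simp [fz])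
    i2 i3 (fun x _ => by fun_prop) (fun x _ => hf.differentiable one_ne_zero x)
  simp only [fz] at e2
  simp at e1 e2
  rw [e1, e2, add_zero]

lemma integral_Yd (n : ℕ) (j : Fin n) (f : Hspace n → ℝ) (hf : ContDiff ℝ 1 f)
    (hc : HasCompactSupport f) : Integrable (Yd n j f) ∧ ∫ p, Yd n j f p = 0 := by
  have hd : ∀ v, Continuous (fun p => fderiv ℝ f p v) := fun v =>
    (hf.continuous_fderiv one_ne_zero).clm_apply continuous_const
  have hs : ∀ v, HasCompactSupport (fun p => fderiv ℝ f p v) := fun v =>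
    hc.fderiv_apply (𝕜 := ℝ) v
  have hi : ∀ v, Integrable (fun p => fderiv ℝ f p v) := fun v =>
    (hd v).integrable_of_hasCompactSupport (hs v)
  have hg : DifferentiableAt ℝ (fun p : Hspace n => 2 * p.1 j) 0 := by fun_prop
  have i2 : Integrable (fun p : Hspace n => 2 * p.1 j * fderiv ℝ f p (0, 0, 1)) :=
    ((by fun_prop : Continuous fun p : Hspace n => 2 * p.1 j).mul
      (hd _)).integrable_of_hasCompactSupport ((hs _).mul_left)
  have i3 : Integrable (fun p : Hspace n => 2 * p.1 j * f p) :=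
    ((by fun_prop : Continuous fun p : Hspace n => 2 * p.1 j).mul
      hf.continuous).integrable_of_hasCompactSupport (hc.mul_left)
  have fz : ∀ p : Hspace n, fderiv ℝ (fun p : Hspace n => 2 * p.1 j) p (0,0,1) = 0 := by
    intro p
    rw [fderiv_const_mul (by fun_prop)]
    simp [fderiv_x]
  refine ⟨(hi _).sub i2, ?_⟩
  unfold Yd
  rw [integral_sub (hi _) i2]
  have e1 := integral_mul_fderiv_eq_neg_fderiv_mul_of_integrable (μ := (volume : Measure (Hspace n)))
    (f := fun _ : Hspace n => (1:ℝ)) (g := f) (v := (0, Pi.single j 1, 0)) (by simp)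
    (by simpa using hi _) (by simpa using hf.continuous.integrable_of_hasCompactSupport hc)
    (fun x _ => by fun_prop) (fun x _ => hf.differentiable one_ne_zero x)
  have e2 := integral_mul_fderiv_eq_neg_fderiv_mul_of_integrable (μ := (volume : Measure (Hspace n)))
    (f := fun p : Hspace n => 2 * p.1 j) (g := f) (v := (0, 0, 1)) (by simp [fz])
    i2 i3 (fun x _ => by fun_prop) (fun x _ => hf.differentiable one_ne_zero x)
  simp only [fz] at e2
  simp at e1 e2
  rw [e1, e2, sub_zero]

def FF (a b η x : ℝ) : ℝ := (1 / 4) * (a * x⁻¹ + b * x ^ (η - 1))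

lemma hasDerivAt_FF (a b η x : ℝ) (hx : 0 < x) :
    HasDerivAt (FF a b η) ((1 / 4) * (-a * x⁻¹ ^ 2 + b * (η - 1) * (x⁻¹ ^ 2 * x ^ η))) x := by
  have h1 := (hasDerivAt_inv hx.ne').const_mul a
  have h2 := (Real.hasDerivAt_rpow_const (x := x) (p := η - 1) (Or.inl hx.ne')).const_mul b
  have h := (h1.add h2).const_mul (1 / 4)
  refine h.congr_deriv ?_
  have : x ^ (η - 1 - 1) = x⁻¹ ^ 2 * x ^ η := by
    rw [Real.rpow_sub_one hx.ne', Real.rpow_sub_one hx.ne']; field_simp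
  rw [this]; field_simp

lemma FF_eq (a b η x : ℝ) (hx : 0 < x) :
    FF a b η x = (1 / 4) * x⁻¹ * (a + b * x ^ η) := by
  unfold FF; rw [Real.rpow_sub_one hx.ne']; field_simp

lemma scalar_ineq (n b η m N N0 δ : ℝ) (hn : 0 ≤ n) (hb : 0 ≤ b) (hη : η ≤ 1)
    (hm : 0 ≤ m) (hN : 0 < N) (hδ : 0 ≤ δ) (hN0 : N = N0 + δ)
    (hbm : b * m ≤ 2 * η) :
    N⁻¹ * (n ^ 2 + 2 * η * b * m) ≤
      16 * N0 * ((1 / 4) * (-n * N⁻¹ ^ 2 + b * (η - 1) * (N⁻¹ ^ 2 * m))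
        - ((1 / 4) * N⁻¹ * (n + b * m)) ^ 2)
      + ((1 / 4) * N⁻¹ * (n + b * m)) * (8 * n + 16) := by
  set r := N⁻¹ with hr
  have hr0 : 0 < r := by positivity
  have hrN : r * N = 1 := inv_mul_cancel₀ hN.ne'
  set G := (1 / 4) * (-n * r ^ 2 + b * (η - 1) * (r ^ 2 * m)) - ((1 / 4) * r * (n + b * m)) ^ 2
    with hG
  have hG0 : G ≤ 0 := by
    have h1 : 0 ≤ n * r ^ 2 := by positivity
    have h2 : 0 ≤ (1 - η) * (b * (r ^ 2 * m)) := by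
      have : 0 ≤ 1 - η := by linarith
      positivity
    have h3 := sq_nonneg ((1 / 4) * r * (n + b * m))
    rw [hG]; nlinarith
  have h4 : 16 * N * G ≤ 16 * N0 * G := by nlinarith
  have h5 : 16 * N * G + ((1 / 4) * r * (n + b * m)) * (8 * n + 16) =
      r * (n ^ 2 + 4 * η * (b * m) - (b * m) ^ 2) := by
    have : 16 * N * G = (r * N) * (r * (4 * (-n + b * (η - 1) * m) - (n + b * m) ^ 2)) := by
      rw [hG]; ring
    rw [this, hrN]; ring
  have h6 : 0 ≤ b * m := by positivity
  have h7 : r * (n ^ 2 + 2 * η * b * m) ≤ r * (n ^ 2 + 4 * η * (b * m) - (b * m) ^ 2) := by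
    apply mul_le_mul_of_nonneg_left _ hr0.le
    nlinarith
  linarith

lemma key_pt (n : ℕ) (δ b η : ℝ) (hδ : 0 < δ) (hb : 0 ≤ b) (hη0 : 0 ≤ η) (hη : η ≤ 1)
    (φ : Hspace n → ℝ) (p : Hspace n) (hφ : DifferentiableAt ℝ φ p)
    (hbm : b * NN n δ p ^ η ≤ 2 * η) :
    zSq n p / NN n δ p * ((n : ℝ) ^ 2 + 2 * η * b * NN n 0 p ^ η) * φ p ^ 2 ≤
      gradH2 n φ p + ∑ j,
        (Xd n j (fun p => φ p ^ 2 * (FF n b η (NN n δ p) * PX n j p)) p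
        + Yd n j (fun p => φ p ^ 2 * (FF n b η (NN n δ p) * PY n j p)) p) := by
  have hN := NN_pos n hδ p
  have hN0 : 0 ≤ NN n 0 p := by unfold NN; positivity
  have hNN : NN n δ p = NN n 0 p + δ := by unfold NN; ring
  have hF := hasDerivAt_FF n b η _ hN
  have hsc := scalar_ineq n b η (NN n δ p ^ η) _ _ δ (by positivity) hb hη (by positivity) hN
    hδ.le hNN hbm
  rw [← FF_eq _ _ _ _ hN] at hsc
  simp_rw [Xd_eq, Yd_eq]
  simp_rw [fun j => fderiv_W n δ φ _ _ _ p (Pi.single j 1, 0, 2 * p.2.1 j) hφ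
      ((contDiff_PX n j).differentiable one_ne_zero p) hF,
    fun j => fderiv_W n δ φ _ _ _ p (0, Pi.single j 1, -(2 * p.1 j)) hφ
      ((contDiff_PY n j).differentiable one_ne_zero p) hF, Xd_NN, Yd_NN, Xd_PX, Yd_PY]
  simp only [gradH2, Xd_eq, Yd_eq]
  set F := FF n b η (NN n δ p)
  set F' := (1 / 4) * (-(n : ℝ) * (NN n δ p)⁻¹ ^ 2 +
    b * (η - 1) * ((NN n δ p)⁻¹ ^ 2 * NN n δ p ^ η))
  have hsum : ∑ j, (4 * zSq n p + 8 * (p.1 j ^ 2 + p.2.1 j ^ 2) + (4 * zSq n p + 8 * (p.1 j ^ 2 + p.2.1 j ^ 2))) =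
      (8 * n + 16) * zSq n p := by
    have : ∀ j, (4 * zSq n p + 8 * (p.1 j ^ 2 + p.2.1 j ^ 2) + (4 * zSq n p + 8 * (p.1 j ^ 2 + p.2.1 j ^ 2)))
      = 8 * zSq n p + 16 * (p.1 j ^ 2 + p.2.1 j ^ 2) := fun j => by ring
    simp_rw [this, Finset.sum_add_distrib, ← Finset.mul_sum]
    rw [Finset.sum_const, Finset.card_univ, Fintype.card_fin]
    change _ + 16 * zSq n p = _
    rw [nsmul_eq_mul]; ring
  have hP := sum_P n p
  have hsq : 0 ≤ ∑ j, ((fderiv ℝ φ p (Pi.single j 1, 0, 2 * p.2.1 j) + φ p * F * PX n j p) ^ 2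
    + (fderiv ℝ φ p (0, Pi.single j 1, -(2 * p.1 j)) + φ p * F * PY n j p) ^ 2) :=
    Finset.sum_nonneg fun j _ => by positivity
  have heq : φ p ^ 2 * (F' - F ^ 2) * (16 * zSq n p * NN n 0 p)
      + φ p ^ 2 * F * ((8 * n + 16) * zSq n p) =
      φ p ^ 2 * zSq n p * (16 * NN n 0 p * (F' - F ^ 2) + F * (8 * n + 16)) := by ring
  have hle : zSq n p / NN n δ p * ((n : ℝ) ^ 2 + 2 * η * b * NN n 0 p ^ η) * φ p ^ 2 ≤
      φ p ^ 2 * zSq n p * (16 * NN n 0 p * (F' - F ^ 2) + F * (8 * n + 16)) := by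
    have h0 : NN n 0 p ^ η ≤ NN n δ p ^ η := Real.rpow_le_rpow hN0 (by linarith) hη0
    have hz := zSq_nonneg n p
    have : zSq n p / NN n δ p * ((n : ℝ) ^ 2 + 2 * η * b * NN n 0 p ^ η) * φ p ^ 2 ≤
      zSq n p / NN n δ p * ((n : ℝ) ^ 2 + 2 * η * b * NN n δ p ^ η) * φ p ^ 2 := by gcongr
    refine this.trans ?_
    have := mul_le_mul_of_nonneg_left hsc (show 0 ≤ φ p ^ 2 * zSq n p by positivity)
    refine le_trans (le_of_eq ?_) this
    rw [div_eq_mul_inv]; ring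
  refine hle.trans ?_
  rw [← heq, ← hP, ← hsum, Finset.mul_sum, Finset.mul_sum, ← Finset.sum_add_distrib, ← Finset.sum_add_distrib]
  refine le_trans (le_add_of_nonneg_left hsq) (le_of_eq ?_)
  rw [← Finset.sum_add_distrib]
  refine Finset.sum_congr rfl fun j _ => ?_
  ring

lemma continuous_gradH2 (n : ℕ) (φ : Hspace n → ℝ) (hφ : ContDiff ℝ 1 φ) :
    Continuous (gradH2 n φ) := by
  have hd : ∀ v, Continuous (fun p => fderiv ℝ φ p v) := fun v =>
    (hφ.continuous_fderiv one_ne_zero).clm_apply continuous_const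
  unfold gradH2 Xd Yd
  fun_prop (disch := assumption)

lemma gradH2_zero (n : ℕ) (φ : Hspace n → ℝ) (p : Hspace n) (hp : p ∉ tsupport φ) :
    gradH2 n φ p = 0 := by
  have : fderiv ℝ φ p = 0 := by
    by_contra h
    exact hp (support_fderiv_subset ℝ h)
  simp [gradH2, Xd, Yd, this]

lemma contDiff_FFN (n : ℕ) (a b η δ : ℝ) (hδ : 0 < δ) :
    ContDiff ℝ 1 (fun p => FF a b η (NN n δ p)) := by
  unfold FF
  have h := contDiff_NN n δ
  have h0 : ∀ p, NN n δ p ≠ 0 := fun p => (NN_pos n hδ p).ne'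
  exact contDiff_const.mul ((contDiff_const.mul (h.inv h0)).add
    (contDiff_const.mul (h.rpow_const_of_ne h0)))

lemma key_int (n : ℕ) (δ b η : ℝ) (hδ : 0 < δ) (hb : 0 ≤ b) (hη0 : 0 ≤ η) (hη : η ≤ 1)
    (φ : Hspace n → ℝ) (hφ : ContDiff ℝ 1 φ) (hc : HasCompactSupport φ)
    (hbm : ∀ p ∈ tsupport φ, b * NN n δ p ^ η ≤ 2 * η) :
    ∫⁻ p, ENNReal.ofReal
      (zSq n p / NN n δ p * ((n : ℝ) ^ 2 + 2 * η * b * NN n 0 p ^ η) * φ p ^ 2) ≤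
    ∫⁻ p, ENNReal.ofReal (gradH2 n φ p) := by
  have hF := contDiff_FFN n n b η δ hδ
  have hφ2 : HasCompactSupport (fun p => φ p ^ 2) := by
    have h := hc.mul_right (f' := φ)
    have e : (fun p => φ p ^ 2) = φ * φ := by ext p; simp [pow_two]
    rw [e]; exact h
  have wX : ∀ j, ContDiff ℝ 1 (fun p => φ p ^ 2 * (FF n b η (NN n δ p) * PX n j p)) := fun j =>
    (hφ.pow 2).mul (hF.mul (contDiff_PX n j))
  have wY : ∀ j, ContDiff ℝ 1 (fun p => φ p ^ 2 * (FF n b η (NN n δ p) * PY n j p)) := fun j =>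
    (hφ.pow 2).mul (hF.mul (contDiff_PY n j))
  have iX := fun j => integral_Xd n j _ (wX j) (hφ2.mul_right)
  have iY := fun j => integral_Yd n j _ (wY j) (hφ2.mul_right)
  have iG : Integrable (gradH2 n φ) :=
    (continuous_gradH2 n φ hφ).integrable_of_hasCompactSupport
      (HasCompactSupport.intro hc (gradH2_zero n φ))
  have cN : ∀ δ, Continuous (NN n δ) := fun δ => (contDiff_NN n δ).continuous
  have iL : Integrable (fun p =>
      zSq n p / NN n δ p * ((n : ℝ) ^ 2 + 2 * η * b * NN n 0 p ^ η) * φ p ^ 2) := by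
    refine Continuous.integrable_of_hasCompactSupport ?_ hφ2.mul_left
    exact (((contDiff_zSq n).continuous.div (cN δ) fun p => (NN_pos n hδ p).ne').mul
      (continuous_const.add (continuous_const.mul
        ((cN 0).rpow_const fun _ => Or.inr hη0)))).mul (hφ.continuous.pow 2)
  have hN0 : ∀ p, 0 ≤ NN n 0 p := fun p => by unfold NN; positivity
  rw [← ofReal_integral_eq_lintegral_ofReal iL, ← ofReal_integral_eq_lintegral_ofReal iG]
  · apply ENNReal.ofReal_le_ofReal
    have iS : Integrable (fun p => ∑ j,
        (Xd n j (fun p => φ p ^ 2 * (FF n b η (NN n δ p) * PX n j p)) p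
        + Yd n j (fun p => φ p ^ 2 * (FF n b η (NN n δ p) * PY n j p)) p)) :=
      integrable_finsetSum _ fun j _ => (iX j).1.add (iY j).1
    have hS : ∫ p, ∑ j,
        (Xd n j (fun p => φ p ^ 2 * (FF n b η (NN n δ p) * PX n j p)) p
        + Yd n j (fun p => φ p ^ 2 * (FF n b η (NN n δ p) * PY n j p)) p) = 0 := by
      refine (integral_finsetSum _ fun j _ => (iX j).1.add (iY j).1).trans ?_
      refine Finset.sum_eq_zero fun j _ => ?_
      refine (integral_add (iX j).1 (iY j).1).trans ?_
      rw [(iX j).2, (iY j).2, add_zero]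
    have := integral_mono iL (iG.add iS) (fun p => by
      by_cases hp : p ∈ tsupport φ
      · exact key_pt n δ b η hδ hb hη0 hη φ p (hφ.differentiable one_ne_zero p) (hbm p hp)
      · have h0 : φ p = 0 := image_eq_zero_of_notMem_tsupport hp
        have hz : ∀ R : Hspace n → ℝ, fderiv ℝ (fun p => φ p ^ 2 * R p) p = 0 := fun R => by
          by_contra h
          apply hp
          have h1 := support_fderiv_subset ℝ h
          refine closure_mono ?_ h1
          intro x hx hx0
          exact hx (by simp [hx0])
        simp [h0, gradH2_zero n φ p hp, Xd, Yd, hz])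
    refine this.trans (le_of_eq ?_)
    simp only [Pi.add_apply]
    rw [integral_add iG iS, hS, add_zero]
  · exact Filter.Eventually.of_forall fun p => Finset.sum_nonneg fun j _ => by positivity
  · refine Filter.Eventually.of_forall fun p => ?_
    have := hN0 p
    have := zSq_nonneg n p
    have := NN_pos n hδ p
    simp only [Pi.zero_apply]
    positivity

open Filter Topology in
lemma hardy_lim (n : ℕ) (Ω : Set (Hspace n)) (hΩo : IsOpen Ω) (b η : ℝ) (hb : 0 ≤ b)
    (hη0 : 0 < η) (hη : η ≤ 1)
    (φ : Hspace n → ℝ) (hφ : ContDiff ℝ 1 φ) (hc : HasCompactSupport φ) (hs : tsupport φ ⊆ Ω)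
    (hbm : ∀ p ∈ Ω, b * NN n 1 p ^ η ≤ 2 * η) :
    ∫⁻ p in Ω, ENNReal.ofReal
      (zSq n p / NN n 0 p * ((n : ℝ) ^ 2 + 2 * η * b * NN n 0 p ^ η) * φ p ^ 2) ≤
    ∫⁻ p in Ω, ENNReal.ofReal (gradH2 n φ p) := by
  have hG : ∫⁻ p in Ω, ENNReal.ofReal (gradH2 n φ p) = ∫⁻ p, ENNReal.ofReal (gradH2 n φ p) := by
    rw [← lintegral_indicator hΩo.measurableSet]
    congr 1
    ext p
    by_cases hp : p ∈ Ω
    · simp [hp]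
    · simp [hp, gradH2_zero n φ p (fun h => hp (hs h))]
  rw [hG]
  let δ : ℕ → ℝ := fun k => 1 / ((k : ℝ) + 1)
  have hδ : ∀ k, 0 < δ k := fun k => by positivity
  have hδ1 : ∀ k, δ k ≤ 1 := fun k => by
    simp only [δ]; rw [div_le_one (by positivity)]; linarith [(Nat.cast_nonneg k : (0:ℝ) ≤ k)]
  have hδt : Tendsto δ atTop (𝓝 0) := tendsto_one_div_add_atTop_nhds_zero_nat
  have mN : ∀ d, Measurable (NN n d) := fun d => (contDiff_NN n d).continuous.measurable
  have mz : Measurable (zSq n) := (contDiff_zSq n).continuous.measurable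
  have mφ : Measurable φ := hφ.continuous.measurable
  have hk : ∀ k, ∫⁻ p in Ω, ENNReal.ofReal
      (zSq n p / NN n (δ k) p * ((n : ℝ) ^ 2 + 2 * η * b * NN n 0 p ^ η) * φ p ^ 2) ≤
      ∫⁻ p, ENNReal.ofReal (gradH2 n φ p) := fun k => by
    refine (setLIntegral_le_lintegral _ _).trans
      (key_int n (δ k) b η (hδ k) hb hη0.le hη φ hφ hc fun p hp => ?_)
    refine le_trans ?_ (hbm p (hs hp))
    have h1 : NN n (δ k) p ≤ NN n 1 p := by unfold NN; linarith [hδ1 k]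
    have := (NN_pos n (hδ k) p).le
    gcongr
  calc _ = ∫⁻ p in Ω, liminf (fun k => ENNReal.ofReal
      (zSq n p / NN n (δ k) p * ((n : ℝ) ^ 2 + 2 * η * b * NN n 0 p ^ η) * φ p ^ 2)) atTop := by
        refine lintegral_congr fun p => ?_
        refine (Tendsto.liminf_eq ?_).symm
        apply ENNReal.tendsto_ofReal
        refine Tendsto.mul_const _ (Tendsto.mul_const _ ?_)
        by_cases h0 : NN n 0 p = 0
        · have : zSq n p = 0 := by
            unfold NN at h0
            nlinarith [sq_nonneg (zSq n p), sq_nonneg p.2.2]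
          simp [this]
        · refine tendsto_const_nhds.div ?_ h0
          have : Tendsto (fun k => NN n 0 p + δ k) atTop (𝓝 (NN n 0 p + 0)) :=
            tendsto_const_nhds.add hδt
          rw [add_zero] at this
          refine this.congr fun k => ?_
          unfold NN; ring
    _ ≤ liminf (fun k => ∫⁻ p in Ω, ENNReal.ofReal
      (zSq n p / NN n (δ k) p * ((n : ℝ) ^ 2 + 2 * η * b * NN n 0 p ^ η) * φ p ^ 2)) atTop := by
        apply lintegral_liminf_le
        intro k
        have := mN (δ k)
        have := mN 0
        fun_prop
    _ ≤ liminf (fun _ : ℕ => ∫⁻ p, ENNReal.ofReal (gradH2 n φ p)) atTop :=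
        liminf_le_liminf (Eventually.of_forall hk)
    _ = _ := liminf_const _

lemma K_finite (n : ℕ) (Ω : Set (Hspace n)) (hΩb : Bornology.IsBounded Ω) :
    ∫⁻ p in Ω, ENNReal.ofReal (NN n 0 p ^ (-(4:ℝ)⁻¹)) < ⊤ := by
  obtain ⟨R, hR⟩ := hΩb.subset_closedBall 0
  have hsub : Ω ⊆ (Metric.closedBall (0 : Fin n → ℝ) R) ×ˢ
      ((Metric.closedBall (0 : Fin n → ℝ) R) ×ˢ (Metric.closedBall (0 : ℝ) R)) := by
    rw [closedBall_prod_same, closedBall_prod_same]; exact hR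
  let g : ℝ → ENNReal := fun t => (ENNReal.ofReal |t|) ^ (-(2:ℝ)⁻¹)
  have mg : Measurable g := by fun_prop
  have hg : ∫⁻ t in Metric.closedBall (0 : ℝ) R, g t < ⊤ := by
    have h1 : IntervalIntegrable (fun t : ℝ => |t| ^ (-(2:ℝ)⁻¹)) volume (-R) R := by
      apply intervalIntegrable_of_even (fun x => by simp)
      intro x hx
      have h := intervalIntegral.intervalIntegrable_rpow' (a := 0) (b := x)
        (r := -(2:ℝ)⁻¹) (by norm_num)
      refine h.congr ?_
      intro t ht
      rw [Set.uIoc_of_le hx.le] at ht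
      simp [abs_of_pos ht.1]
    rcases lt_or_ge R 0 with hR0 | hR0
    · rw [Metric.closedBall_eq_empty.2 hR0]; simp
    have h2 : IntegrableOn (fun t : ℝ => |t| ^ (-(2:ℝ)⁻¹)) (Metric.closedBall (0 : ℝ) R) := by
      rw [Real.closedBall_eq_Icc, zero_sub, zero_add]
      exact (intervalIntegrable_iff_integrableOn_Icc_of_le (by linarith)).1 h1
    have h3 := h2.lintegral_lt_top
    refine lt_of_le_of_lt (le_of_eq ?_) h3
    refine lintegral_congr_ae (ae_restrict_of_ae ?_)
    have : ∀ᵐ t : ℝ, t ≠ 0 := by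
      simp [ae_iff]
    filter_upwards [this] with t ht
    simp only [g]
    rw [ENNReal.ofReal_rpow_of_pos (abs_pos.2 ht)]
  have hpt : ∀ p : Hspace n, ENNReal.ofReal (NN n 0 p ^ (-(4:ℝ)⁻¹)) ≤ 1 * (1 * g p.2.2) := by
    intro p
    rw [one_mul, one_mul]
    by_cases ht : p.2.2 = 0
    · simp [g, ht, ENNReal.zero_rpow_of_neg]
    · simp only [g]
      rw [ENNReal.ofReal_rpow_of_pos (abs_pos.2 ht)]
      apply ENNReal.ofReal_le_ofReal
      have hp := abs_pos.2 ht
      have : |p.2.2| ^ (-(2:ℝ)⁻¹) = (p.2.2 ^ 2) ^ (-(4:ℝ)⁻¹) := by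
        rw [← sq_abs, ← Real.rpow_natCast, ← Real.rpow_mul hp.le]; norm_num
      rw [this]
      apply Real.rpow_le_rpow_of_nonpos (by positivity) _ (by norm_num)
      unfold NN; nlinarith [sq_nonneg (zSq n p)]
  calc _ ≤ ∫⁻ p in Ω, 1 * (1 * g p.2.2) := lintegral_mono hpt
    _ ≤ ∫⁻ p in (Metric.closedBall (0 : Fin n → ℝ) R) ×ˢ
      ((Metric.closedBall (0 : Fin n → ℝ) R) ×ˢ (Metric.closedBall (0 : ℝ) R)),
        1 * (1 * g p.2.2) := lintegral_mono_set hsub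
    _ = volume (Metric.closedBall (0 : Fin n → ℝ) R) * (volume (Metric.closedBall (0 : Fin n → ℝ) R)
        * ∫⁻ t in Metric.closedBall (0 : ℝ) R, g t) := by
      rw [Measure.volume_eq_prod, ← Measure.prod_restrict, Measure.volume_eq_prod,
        ← Measure.prod_restrict]
      rw [lintegral_prod_mul (f := fun _ => 1) (g := fun y : (Fin n → ℝ) × ℝ => 1 * g y.2)
        (by fun_prop) (by fun_prop)]
      rw [lintegral_prod_mul (f := fun _ => 1) (g := g) (by fun_prop) (by fun_prop)]
      simp
    _ < ⊤ := ENNReal.mul_lt_top measure_closedBall_lt_top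
      (ENNReal.mul_lt_top measure_closedBall_lt_top hg)

lemma rho_sq (n : ℕ) (p : Hspace n) : rho n p ^ 2 = NN n 0 p ^ ((2:ℝ)⁻¹) := by
  unfold rho NN
  rw [← Real.rpow_natCast, ← Real.rpow_mul (by positivity), add_zero]; norm_num

lemma rho_four (n : ℕ) (p : Hspace n) : rho n p ^ 4 = NN n 0 p := by
  unfold rho NN
  rw [← Real.rpow_natCast, ← Real.rpow_mul (by positivity), add_zero]; norm_num

lemma holder_final (n : ℕ) (Ω : Set (Hspace n)) (q pe η : ℝ) (hq1 : 1 < q) (hq2 : q < 2)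
    (hpq : 1 / pe + 1 / q = 1) (hη : η = (2 - q) / (4 * q)) (φ : Hspace n → ℝ)
    (hφ : ContDiff ℝ 1 φ) :
    ∫⁻ p in Ω, ENNReal.ofReal ((zSq n p / rho n p ^ 2) * (φ p) ^ 2) ≤
      (∫⁻ p in Ω, ENNReal.ofReal (Real.sqrt (zSq n p) ^ pe * |φ p| ^ pe)) ^ (pe⁻¹) *
      ((∫⁻ p in Ω, ENNReal.ofReal (zSq n p / NN n 0 p * NN n 0 p ^ η * φ p ^ 2)) ^ ((2:ℝ)⁻¹) *
        (∫⁻ p in Ω, ENNReal.ofReal (NN n 0 p ^ (-(4:ℝ)⁻¹))) ^ ((2 - q) / (2 * q))) := by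
  have hpe : pe.HolderConjugate q := by
    have : q.HolderConjugate pe := by
      refine (Real.holderConjugate_iff).2 ⟨hq1, ?_⟩
      rw [← hpq]; simp [add_comm]
    exact this.symm
  have hq0 : 0 < q := by linarith
  have h2q : (2 / q).HolderConjugate (2 / (2 - q)) := by
    refine (Real.holderConjugate_iff).2 ⟨by rw [lt_div_iff₀ hq0]; linarith, ?_⟩
    field_simp; ring
  have mN : Measurable (NN n 0) := (contDiff_NN n 0).continuous.measurable
  have mz : Measurable (zSq n) := (contDiff_zSq n).continuous.measurable
  have mφ : Measurable φ := hφ.continuous.measurable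
  have hN0 : ∀ p, 0 ≤ NN n 0 p := fun p => by unfold NN; positivity
  have hzN : ∀ p, NN n 0 p = 0 → zSq n p = 0 := fun p h0 => by
    unfold NN at h0
    nlinarith [sq_nonneg (zSq n p), sq_nonneg p.2.2]
  let α : Hspace n → ENNReal := fun p => ENNReal.ofReal (√(zSq n p) * |φ p|)
  let γ : Hspace n → ENNReal := fun p => ENNReal.ofReal (√(zSq n p) * |φ p| * NN n 0 p ^ ((η - 1) / 2))
  let κ : Hspace n → ENNReal := fun p => ENNReal.ofReal (NN n 0 p ^ (-η / 2))
  have mα : Measurable α := by fun_prop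
  have mγ : Measurable γ := by fun_prop
  have mκ : Measurable κ := by fun_prop
  have e1 : ∀ p, ENNReal.ofReal ((zSq n p / rho n p ^ 2) * (φ p) ^ 2) = (α * (γ * κ)) p := by
    intro p
    have hz := zSq_nonneg n p
    simp only [α, γ, κ, Pi.mul_apply]
    have := hN0 p
    rw [← ENNReal.ofReal_mul (by positivity), ← ENNReal.ofReal_mul (by positivity)]
    congr 1
    rcases (hN0 p).eq_or_lt with h | h
    · simp [hzN p h.symm]
    have h1 : NN n 0 p ^ ((η - 1) / 2) * NN n 0 p ^ (-η / 2) = (NN n 0 p ^ ((2:ℝ)⁻¹))⁻¹ := by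
      rw [← Real.rpow_add h, ← Real.rpow_neg h.le]; congr 1; ring
    rw [rho_sq, ← sq_abs (φ p)]
    calc _ = (√(zSq n p) * √(zSq n p)) * (NN n 0 p ^ ((2:ℝ)⁻¹))⁻¹ * |φ p| ^ 2 := by
          rw [Real.mul_self_sqrt hz]; rfl
      _ = _ := by rw [← h1]; ring
  have e2 : ∀ p, α p ^ pe = ENNReal.ofReal (Real.sqrt (zSq n p) ^ pe * |φ p| ^ pe) := by
    intro p
    simp only [α]
    rw [ENNReal.ofReal_rpow_of_nonneg (by positivity) hpe.nonneg,
      Real.mul_rpow (by positivity) (by positivity)]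
  have e3 : ∀ p, (γ p ^ q) ^ (2 / q) =
      ENNReal.ofReal (zSq n p / NN n 0 p * NN n 0 p ^ η * φ p ^ 2) := by
    intro p
    rw [← ENNReal.rpow_mul, mul_div_cancel₀ _ hq0.ne']
    simp only [γ]
    have := hN0 p
    rw [ENNReal.ofReal_rpow_of_nonneg (by positivity) (by norm_num)]
    congr 1
    rcases (hN0 p).eq_or_lt with h | h
    · simp [hzN p h.symm]
    rw [show (2:ℝ) = ((2:ℕ):ℝ) by norm_num, Real.rpow_natCast, mul_pow, mul_pow,
      Real.sq_sqrt (zSq_nonneg n p), sq_abs, ← Real.rpow_natCast (NN n 0 p ^ _),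
      ← Real.rpow_mul h.le]
    have : (η - 1) / ((2:ℕ):ℝ) * ((2:ℕ):ℝ) = η - 1 := by push_cast; ring
    rw [this, Real.rpow_sub_one h.ne']
    ring
  have e4 : ∀ p, (κ p ^ q) ^ (2 / (2 - q)) = ENNReal.ofReal (NN n 0 p ^ (-(4:ℝ)⁻¹)) := by
    intro p
    rw [← ENNReal.rpow_mul]
    simp only [κ]
    have := hN0 p
    have h2 : 0 < 2 - q := by linarith
    rw [ENNReal.ofReal_rpow_of_nonneg (by positivity) (by positivity), ← Real.rpow_mul this]
    congr 2
    rw [hη]; field_simp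
  have H1 := ENNReal.lintegral_mul_le_Lp_mul_Lq (volume.restrict Ω) hpe mα.aemeasurable
    (mγ.mul mκ).aemeasurable
  have H2 := ENNReal.lintegral_mul_le_Lp_mul_Lq (volume.restrict Ω) h2q
    (mγ.pow_const q).aemeasurable (mκ.pow_const q).aemeasurable
  simp only [← e1, e2] at H1
  simp only [e3, e4] at H2
  rw [one_div] at H1
  refine H1.trans (mul_le_mul_right ?_ _)
  have : ∀ p, (γ * κ) p ^ q = ((fun p => γ p ^ q) * (fun p => κ p ^ q)) p := fun p => by
    simp only [Pi.mul_apply]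
    rw [ENNReal.mul_rpow_of_nonneg _ _ hq0.le]
  simp only [this]
  refine (ENNReal.rpow_le_rpow H2 (by positivity)).trans (le_of_eq ?_)
  rw [ENNReal.mul_rpow_of_nonneg _ _ (by positivity), ← ENNReal.rpow_mul, ← ENNReal.rpow_mul]
  congr 2 <;> · field_simp

/-- interpolation inequality on ℍⁿ: for a bounded smooth domain `Ω ∋ 0`,
`1 < q < 2` and `1/pe + 1/q = 1`, there exists `C > 0` with
`[∫_Ω |∇_ℍ φ|² − ((Q−2)/2)² ∫_Ω (|z|²/ρ⁴) φ²]^{1/2} · (∫_Ω |z|^pe |φ|^pe)^{1/pe}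
  ≥ √C ((Q − q)/q) ∫_Ω (|z|²/ρ²) φ²` for all `φ ∈ C_c^∞(Ω)`. -/
theorem heisenberg_interpolation (n : ℕ) (hn : 1 ≤ n) (Q : ℝ) (hQ : Q = 2 * n + 2)
    (Ω : Set (Hspace n)) (hΩo : IsOpen Ω) (hΩb : Bornology.IsBounded Ω)
    (h0Ω : (0 : Hspace n) ∈ Ω) (q pe : ℝ) (hq1 : 1 < q) (hq2 : q < 2)
    (hpq : 1 / pe + 1 / q = 1) :
    ∃ C : ℝ, 0 < C ∧ ∀ φ : Hspace n → ℝ, ContDiff ℝ (⊤ : ℕ∞) φ → HasCompactSupport φ →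
      tsupport φ ⊆ Ω →
      ((∫⁻ p in Ω, ENNReal.ofReal (gradH2 n φ p)) -
            ENNReal.ofReal (((Q - 2) / 2) ^ 2) *
              (∫⁻ p in Ω, ENNReal.ofReal ((zSq n p / rho n p ^ 4) * (φ p) ^ 2))) ^ ((2 : ℝ)⁻¹) *
          (∫⁻ p in Ω, ENNReal.ofReal (Real.sqrt (zSq n p) ^ pe * |φ p| ^ pe)) ^ (pe⁻¹) ≥
        ENNReal.ofReal (Real.sqrt C * ((Q - q) / q)) *
          ∫⁻ p in Ω, ENNReal.ofReal ((zSq n p / rho n p ^ 2) * (φ p) ^ 2) := by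
  subst hQ
  have hn1 : (1:ℝ) ≤ n := by exact_mod_cast hn
  have hq0 : 0 < q := by linarith
  set η : ℝ := (2 - q) / (4 * q) with hη
  have hη0 : 0 < η := div_pos (by linarith) (by linarith)
  have hη1 : η ≤ 1 := by rw [hη, div_le_one (by linarith)]; linarith
  have hK := K_finite n Ω hΩb
  set K := ∫⁻ p in Ω, ENNReal.ofReal (NN n 0 p ^ (-(4:ℝ)⁻¹)) with hKdef
  obtain ⟨B, hB⟩ := (hΩb.isCompact_closure.image (contDiff_NN n 1).continuous).bddAbove
  have hB' : ∀ p ∈ Ω, NN n 1 p ≤ B := fun p hp => hB ⟨p, subset_closure hp, rfl⟩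
  have hB0 : 0 < B := (NN_pos n one_pos 0).trans_le (hB' 0 h0Ω)
  set b : ℝ := 2 * η / B ^ η with hbdef
  have hBη : 0 < B ^ η := Real.rpow_pos_of_pos hB0 _
  have hb : 0 < b := by positivity
  have hbm : ∀ p ∈ Ω, b * NN n 1 p ^ η ≤ 2 * η := fun p hp => by
    have h1 : NN n 1 p ^ η ≤ B ^ η :=
      Real.rpow_le_rpow (NN_pos n one_pos p).le (hB' p hp) hη0.le
    calc b * NN n 1 p ^ η ≤ b * B ^ η := by gcongr
      _ = 2 * η := by rw [hbdef]; field_simp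
  set c : ℝ := 2 * η * b with hc
  have hc0 : 0 < c := by positivity
  set Kr : ENNReal := K ^ ((2 - q) / (2 * q)) with hKr
  have hKr' : Kr ≠ ⊤ := (ENNReal.rpow_lt_top_of_nonneg
    (div_nonneg (by linarith) (by linarith)) hK.ne).ne
  set m : ℝ := (2 * n + 2 - q) / q with hm
  have hm0 : 0 < m := div_pos (by linarith) hq0
  set k : ℝ := √c / (m * (Kr.toReal + 1)) with hk
  have hk0 : 0 < k := by
    have := ENNReal.toReal_nonneg (a := Kr)
    have := Real.sqrt_pos.2 hc0
    positivity
  refine ⟨k ^ 2, by positivity, fun φ hφ' hcs hsupp => ?_⟩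
  have hφ : ContDiff ℝ 1 φ := hφ'.of_le (by exact_mod_cast le_top)
  rw [Real.sqrt_sq hk0.le]
  have hN0 : ∀ p, 0 ≤ NN n 0 p := fun p => by unfold NN; positivity
  have mN : Measurable (NN n 0) := (contDiff_NN n 0).continuous.measurable
  have mz : Measurable (zSq n) := (contDiff_zSq n).continuous.measurable
  have mφ : Measurable φ := hφ.continuous.measurable
  have H1 := hardy_lim n Ω hΩo b η hb.le hη0 hη1 φ hφ hcs hsupp hbm
  have H2 := holder_final n Ω q pe η hq1 hq2 hpq hη φ hφ
  have hA : ∫⁻ p in Ω, ENNReal.ofReal (gradH2 n φ p) ≠ ⊤ := by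
    have iG : Integrable (gradH2 n φ) :=
      (continuous_gradH2 n φ hφ).integrable_of_hasCompactSupport
        (HasCompactSupport.intro hcs (gradH2_zero n φ))
    exact iG.restrict.lintegral_lt_top.ne
  set A := ∫⁻ p in Ω, ENNReal.ofReal (gradH2 n φ p)
  set D := ∫⁻ p in Ω, ENNReal.ofReal (zSq n p / NN n 0 p * NN n 0 p ^ η * φ p ^ 2)
  have hsplit : ∫⁻ p in Ω, ENNReal.ofReal
      (zSq n p / NN n 0 p * ((n : ℝ) ^ 2 + 2 * η * b * NN n 0 p ^ η) * φ p ^ 2) =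
      ENNReal.ofReal (((2 * n + 2 - 2 : ℝ) / 2) ^ 2) *
        (∫⁻ p in Ω, ENNReal.ofReal ((zSq n p / rho n p ^ 4) * (φ p) ^ 2)) +
      ENNReal.ofReal c * D := by
    rw [← lintegral_const_mul _ (by simp only [rho_four]; fun_prop),
      ← lintegral_const_mul _ (by fun_prop), ← lintegral_add_left (by simp only [rho_four]; fun_prop)]
    refine lintegral_congr fun p => ?_
    have := hN0 p
    have := zSq_nonneg n p
    rw [rho_four, ← ENNReal.ofReal_mul (by positivity), ← ENNReal.ofReal_mul (by positivity),
      ← ENNReal.ofReal_add (by positivity) (by positivity)]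
    congr 1
    rw [hc]; ring
  rw [hsplit] at H1
  set B' := ENNReal.ofReal (((2 * n + 2 - 2 : ℝ) / 2) ^ 2) *
        (∫⁻ p in Ω, ENNReal.ofReal ((zSq n p / rho n p ^ 4) * (φ p) ^ 2))
  set M := ∫⁻ p in Ω, ENNReal.ofReal (Real.sqrt (zSq n p) ^ pe * |φ p| ^ pe)
  have hB't : B' ≠ ⊤ := ne_top_of_le_ne_top hA (le_self_add.trans H1)
  have hcD : ENNReal.ofReal c * D ≤ A - B' := ENNReal.le_sub_of_add_le_left hB't H1
  have hkK : ENNReal.ofReal (k * m) * Kr ≤ ENNReal.ofReal c ^ ((2:ℝ)⁻¹) := by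
    rw [← ENNReal.ofReal_toReal hKr', ENNReal.ofReal_rpow_of_pos hc0,
      ← ENNReal.ofReal_mul (by positivity)]
    apply ENNReal.ofReal_le_ofReal
    have h0 := ENNReal.toReal_nonneg (a := Kr)
    rw [← one_div, ← Real.sqrt_eq_rpow]
    have : k * m = √c / (Kr.toReal + 1) := by rw [hk]; field_simp
    rw [this, div_mul_eq_mul_div, div_le_iff₀ (by positivity)]
    nlinarith [Real.sqrt_nonneg c]
  calc ENNReal.ofReal (k * m) * ∫⁻ p in Ω, ENNReal.ofReal ((zSq n p / rho n p ^ 2) * (φ p) ^ 2)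
      ≤ ENNReal.ofReal (k * m) * (M ^ pe⁻¹ * (D ^ ((2:ℝ)⁻¹) * Kr)) := mul_le_mul_right H2 _
    _ = (ENNReal.ofReal (k * m) * Kr) * D ^ ((2:ℝ)⁻¹) * M ^ pe⁻¹ := by ring
    _ ≤ ENNReal.ofReal c ^ ((2:ℝ)⁻¹) * D ^ ((2:ℝ)⁻¹) * M ^ pe⁻¹ := by gcongr
    _ = (ENNReal.ofReal c * D) ^ ((2:ℝ)⁻¹) * M ^ pe⁻¹ := by
      rw [ENNReal.mul_rpow_of_nonneg _ _ (by norm_num)]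
    _ ≤ (A - B') ^ ((2:ℝ)⁻¹) * M ^ pe⁻¹ := by gcongr
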